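/- Let (𝒲ⁿ, 𝒱ⁿ)_{n≥1} be a GAVWC and for each n let vₙ be the minimum of Vⁿ(z|x) over all Vⁿ ∈ 𝒱ⁿ, x ∈ 𝒳ⁿ, z ∈ 𝒵ⁿ with Vⁿ(z|x) > 0. If lim_{n→∞} (1/n)·log₂ log₂ |𝒲ⁿ| = lim_{n→∞} (1/n)·log₂ log₂ |𝒱ⁿ| = lim_{n→∞} (1/n)·log₂ log₂ (1/vₙ) = 0 (where log₂ log₂ of a quantity equal to 1 is interpreted as 0), then C_{a-str}(𝒲ⁿ,𝒱ⁿ) = C_{m-mis}(𝒲ⁿ,𝒱ⁿ). -/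

import Mathlib

open scoped BigOperators

noncomputable section

/-- A probability distribution on a finite type. -/
def IsProbDist {α : Type} [Fintype α] (p : α → ℝ) : Prop :=
  (∀ a, 0 ≤ p a) ∧ (∑ a, p a) = 1

/-- A channel (stochastic matrix) from `α` to `β`. -/
def IsChannel {α β : Type} [Fintype β] (W : α → β → ℝ) : Prop :=
  ∀ a, IsProbDist (W a)

/-- Output distribution of channel `V` under random encoder `Φ` on message `u`. -/
def Zout {U X Z : Type} [Fintype X] (Φ : U → X → ℝ) (V : X → Z → ℝ) (u : U) (z : Z) : ℝ :=
  ∑ x, Φ u x * V x z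

/-- Probability that the decoder `ψ` fails on message `u`. -/
def errProb {U X Y : Type} [Fintype X] [Fintype Y] [DecidableEq U]
    (W : X → Y → ℝ) (Φ : U → X → ℝ) (ψ : Y → U) (u : U) : ℝ :=
  ∑ y, (if ψ y ≠ u then Zout Φ W u y else 0)

/-- Shannon mutual information (natural logarithm) of the joint law `p u * q u z`. -/
def mutualInfo {U Z : Type} [Fintype U] [Fintype Z] (p : U → ℝ) (q : U → Z → ℝ) : ℝ :=
  ∑ u, ∑ z, p u * q u z * Real.log (q u z / (∑ v, p v * q v z))

/-- A general arbitrarily varying wiretap channel. -/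
structure GAVWC where
  X : ℕ → Type
  Y : ℕ → Type
  Z : ℕ → Type
  SW : ℕ → Type
  SV : ℕ → Type
  fX : ∀ n, Fintype (X n)
  fY : ∀ n, Fintype (Y n)
  fZ : ∀ n, Fintype (Z n)
  fSW : ∀ n, Fintype (SW n)
  fSV : ∀ n, Fintype (SV n)
  neX : ∀ n, Nonempty (X n)
  neY : ∀ n, Nonempty (Y n)
  neZ : ∀ n, Nonempty (Z n)
  neSW : ∀ n, Nonempty (SW n)
  neSV : ∀ n, Nonempty (SV n)
  W : ∀ n, SW n → X n → Y n → ℝ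
  V : ∀ n, SV n → X n → Z n → ℝ
  chanW : ∀ n s, @IsChannel (X n) (Y n) (fY n) (W n s)
  chanV : ∀ n s, @IsChannel (X n) (Z n) (fZ n) (V n s)

/-- `R` is achievable with average error and strong secrecy. -/
def GAVWC.achAStr (C : GAVWC) (R : ℝ) : Prop :=
  0 ≤ R ∧
  ∀ ε > (0:ℝ), ∀ lam > (0:ℝ), ∀ mu > (0:ℝ), ∃ N : ℕ, ∀ n ≥ N,
    letI := C.fX n; letI := C.fY n; letI := C.fZ n
    ∃ (M : ℕ) (Φ : Fin M → C.X n → ℝ) (ψ : C.Y n → Fin M),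
      0 < M ∧
      (∀ u, IsProbDist (Φ u)) ∧
      (n : ℝ)⁻¹ * Real.logb 2 M > R - ε ∧
      (∀ s : C.SW n, (∑ u, (M : ℝ)⁻¹ * errProb (C.W n s) Φ ψ u) ≤ lam) ∧
      (∀ s : C.SV n,
        mutualInfo (fun _ : Fin M => (M : ℝ)⁻¹) (fun u => Zout Φ (C.V n s) u) ≤ mu)

/-- `R` is achievable with maximal error and mutual-information (semantic) security. -/
def GAVWC.achMMis (C : GAVWC) (R : ℝ) : Prop :=
  0 ≤ R ∧
  ∀ ε > (0:ℝ), ∀ lam > (0:ℝ), ∀ mu > (0:ℝ), ∃ N : ℕ, ∀ n ≥ N,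
    letI := C.fX n; letI := C.fY n; letI := C.fZ n
    ∃ (M : ℕ) (Φ : Fin M → C.X n → ℝ) (ψ : C.Y n → Fin M),
      0 < M ∧
      (∀ u, IsProbDist (Φ u)) ∧
      (n : ℝ)⁻¹ * Real.logb 2 M > R - ε ∧
      (∀ s : C.SW n, ∀ u, errProb (C.W n s) Φ ψ u ≤ lam) ∧
      (∀ s : C.SV n, ∀ p : Fin M → ℝ, IsProbDist p →
        mutualInfo p (fun u => Zout Φ (C.V n s) u) ≤ mu)

/-- Capacity for average error and strong secrecy (`0` if no rate is achievable). -/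
def GAVWC.CaStr (C : GAVWC) : ℝ := sSup {R | C.achAStr R}

/-- Capacity for maximal error and mutual-information security (`0` if no rate is achievable). -/
def GAVWC.CmMis (C : GAVWC) : ℝ := sSup {R | C.achMMis R}


/-- The number of main channels at blocklength `n`. -/
def GAVWC.cardW (C : GAVWC) (n : ℕ) : ℕ := @Fintype.card (C.SW n) (C.fSW n)

/-- The number of wiretap channels at blocklength `n`. -/
def GAVWC.cardV (C : GAVWC) (n : ℕ) : ℕ := @Fintype.card (C.SV n) (C.fSV n)

/-- `vₙ`: the minimum of `Vⁿ(z|x)` over all wiretap channels `Vⁿ ∈ 𝒱ⁿ` and all `x`, `z`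
with `Vⁿ(z|x) > 0`. -/
def GAVWC.vmin (C : GAVWC) (n : ℕ) : ℝ :=
  sInf {r : ℝ | 0 < r ∧ ∃ (s : C.SV n) (x : C.X n) (z : C.Z n), C.V n s x z = r}

/-- Double logarithm (base `2`), with the convention `log₂ log₂ 1 = 0`
(indeed `Real.logb 2 0 = 0` in Mathlib). -/
def loglog (x : ℝ) : ℝ := Real.logb 2 (Real.logb 2 x)

/-- A random coloring keeps all color classes of finitely many weight functions below their
exponential-moment thresholds. -/
theorem exists_coloring_sum_lt {ι : Type} [Fintype ι] {M K : ℕ} (hK : 0 < K)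
    (b d : ι → Fin M → ℝ) (t : ι → ℝ) (τ : ℝ)
    (hbd : ∀ i m, Real.exp (b i m) - 1 ≤ d i m)
    (ht : ∀ i, (∑ m, d i m) / K + τ ≤ t i)
    (hc : (Fintype.card ι : ℝ) * K < Real.exp τ) :
    ∃ f : Fin M → Fin K, ∀ u i, ∑ m with f m = u, b i m < t i := by
  by_contra! hbad
  have hK' : (0 : ℝ) < K := by exact_mod_cast hK
  have hone : ∀ f : Fin M → Fin K,
      (1 : ℝ) ≤ ∑ u, ∑ i, Real.exp ((∑ m, if f m = u then b i m else 0) - t i) := by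
    intro f
    obtain ⟨u, i, h⟩ := hbad f
    rw [Finset.sum_filter] at h
    calc (1 : ℝ) ≤ Real.exp ((∑ m, if f m = u then b i m else 0) - t i) :=
          Real.one_le_exp (by linarith)
      _ ≤ ∑ i, Real.exp ((∑ m, if f m = u then b i m else 0) - t i) :=
          Finset.single_le_sum
            (f := fun i => Real.exp ((∑ m, if f m = u then b i m else 0) - t i))
            (fun _ _ => (Real.exp_pos _).le) (Finset.mem_univ i)
      _ ≤ _ := Finset.single_le_sum
            (f := fun u => ∑ i, Real.exp ((∑ m, if f m = u then b i m else 0) - t i))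
            (fun _ _ => Finset.sum_nonneg fun _ _ => (Real.exp_pos _).le) (Finset.mem_univ u)
  have hmoment : ∀ u i,
      ∑ f : Fin M → Fin K, Real.exp ((∑ m, if f m = u then b i m else 0) - t i)
        ≤ (K : ℝ) ^ M * Real.exp (-τ) := by
    intro u i
    have hfactor : ∀ m, ∑ c : Fin K, Real.exp (if c = u then b i m else 0)
        ≤ K * Real.exp (d i m / K) := by
      intro m
      have h1 : ∀ c : Fin K, Real.exp (if c = u then b i m else 0)
          = 1 + if c = u then Real.exp (b i m) - 1 else 0 := by
        intro c; split_ifs <;> simp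
      simp only [h1, Finset.sum_add_distrib]
      simp only [Finset.sum_const, Finset.card_univ, Fintype.card_fin, nsmul_eq_mul, mul_one,
        Finset.sum_ite_eq', Finset.mem_univ, if_true]
      have h2 := Real.add_one_le_exp (d i m / K)
      have h3 : (K : ℝ) * (d i m / K + 1) = K + d i m := by field_simp; ring
      nlinarith [hbd i m, mul_le_mul_of_nonneg_left h2 hK'.le]
    have hprod : ∑ f : Fin M → Fin K, ∏ m, Real.exp (if f m = u then b i m else 0)
        = ∏ m, ∑ c : Fin K, Real.exp (if c = u then b i m else 0) := by
      rw [Finset.prod_univ_sum, Fintype.piFinset_univ]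
    calc ∑ f : Fin M → Fin K, Real.exp ((∑ m, if f m = u then b i m else 0) - t i)
        = Real.exp (-t i) * ∏ m, ∑ c : Fin K, Real.exp (if c = u then b i m else 0) := by
          rw [← hprod, Finset.mul_sum]
          refine Finset.sum_congr rfl fun f _ => ?_
          rw [← Real.exp_sum, ← Real.exp_add]
          ring_nf
      _ ≤ Real.exp (-t i) * ∏ m : Fin M, ((K : ℝ) * Real.exp (d i m / K)) := by
          refine mul_le_mul_of_nonneg_left ?_ (Real.exp_pos _).le
          exact Finset.prod_le_prod
            (fun _ _ => Finset.sum_nonneg fun _ _ => (Real.exp_pos _).le) fun m _ => hfactor m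
      _ = (K : ℝ) ^ M * Real.exp ((∑ m, d i m) / K - t i) := by
          rw [Finset.prod_mul_distrib, ← Real.exp_sum, ← Finset.sum_div, sub_eq_add_neg,
            Real.exp_add]
          simp only [Finset.prod_const, Finset.card_univ, Fintype.card_fin]
          ring
      _ ≤ (K : ℝ) ^ M * Real.exp (-τ) := by
          refine mul_le_mul_of_nonneg_left (Real.exp_le_exp.2 ?_) (by positivity)
          linarith [ht i]
  have htotal : ((K : ℝ) ^ M) ≤ K * (Fintype.card ι * ((K : ℝ) ^ M * Real.exp (-τ))) := by
    calc ((K : ℝ) ^ M) = ∑ f : Fin M → Fin K, (1 : ℝ) := by simp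
      _ ≤ ∑ f : Fin M → Fin K,
            ∑ u, ∑ i, Real.exp ((∑ m, if f m = u then b i m else 0) - t i) :=
          Finset.sum_le_sum fun f _ => hone f
      _ = ∑ u, ∑ i, ∑ f : Fin M → Fin K,
            Real.exp ((∑ m, if f m = u then b i m else 0) - t i) := by
          rw [Finset.sum_comm]
          exact Finset.sum_congr rfl fun u _ => Finset.sum_comm
      _ ≤ ∑ u : Fin K, ∑ i : ι, (K : ℝ) ^ M * Real.exp (-τ) :=
          Finset.sum_le_sum fun u _ => Finset.sum_le_sum fun i _ => hmoment u i
      _ = _ := by simp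
  have hKM : (0 : ℝ) < (K : ℝ) ^ M := by positivity
  have hlt : (Fintype.card ι : ℝ) * K * Real.exp (-τ) < 1 := by
    calc _ < Real.exp τ * Real.exp (-τ) := mul_lt_mul_of_pos_right hc (Real.exp_pos _)
      _ = 1 := by rw [← Real.exp_add]; simp
  nlinarith

/-- If finitely many `[0, B]`-valued functions have mean at most `κ`, some coloring makes all
their averages over color classes at most `16 * κ`. -/
theorem exists_coloring_average_le {ι : Type} [Fintype ι] {M K : ℕ} (hK : 0 < K)
    (a : ι → Fin M → ℝ) {B κ : ℝ} (hκ : 0 < κ) (hκB : κ ≤ B)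
    (ha0 : ∀ i m, 0 ≤ a i m) (haB : ∀ i m, a i m ≤ B)
    (hsum : ∀ i, ∑ m, a i m ≤ M * κ)
    (hc : ((Fintype.card ι : ℝ) + 1) * K < Real.exp (κ * M / (4 * B * K))) :
    ∃ f : Fin M → Fin K, ∀ u, 0 < (Finset.univ.filter fun m => f m = u).card ∧
      ∀ i, ∑ m with f m = u, a i m ≤
        16 * κ * (Finset.univ.filter fun m => f m = u).card := by
  have hK' : (0 : ℝ) < K := by exact_mod_cast hK
  have hB : 0 < B := hκ.trans_le hκB
  have hM : (0 : ℝ) < M := by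
    rcases Nat.eq_zero_or_pos M with rfl | h
    · exfalso
      simp only [Nat.cast_zero, mul_zero, zero_div, Real.exp_zero] at hc
      have : (1 : ℝ) ≤ K := by exact_mod_cast hK
      nlinarith [(Nat.cast_nonneg (Fintype.card ι) : (0 : ℝ) ≤ _)]
    · exact_mod_cast h
  have hL : 0 < (M : ℝ) / K := by positivity
  have hcB : 0 < κ / B := by positivity
  have hcB1 : κ / B ≤ 1 := (div_le_one hB).2 hκB
  have hτ : κ * M / (4 * B * K) = (κ / B) * (M / K) / 4 := by field_simp
  have hexp : Real.exp (-1) ≤ 1 / 2 := by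
    rw [Real.exp_neg, ← one_div]
    exact one_div_le_one_div_of_le (by norm_num) (by linarith [Real.add_one_le_exp (1 : ℝ)])
  obtain ⟨f, hf⟩ := exists_coloring_sum_lt (ι := Option ι) hK
    (fun o m => o.elim (-1) fun i => a i m / B)
    (fun o m => o.elim (-(1 / 2)) fun i => 2 * (a i m / B))
    (fun o => o.elim (-(M / K / 4)) fun _ => 4 * ((κ / B) * (M / K)))
    (κ * M / (4 * B * K))
    (by
      rintro (_ | i) m
      · simp only [Option.elim]; linarith
      · simp only [Option.elim]
        have h0 : 0 ≤ a i m / B := div_nonneg (ha0 i m) hB.le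
        have h1 : a i m / B ≤ 1 := (div_le_one hB).2 (haB i m)
        have h := Real.abs_exp_sub_one_le (abs_le.2 ⟨by linarith, h1⟩)
        rw [abs_of_nonneg h0] at h
        exact (le_abs_self _).trans h)
    (by
      rintro (_ | i)
      · simp only [Option.elim, Finset.sum_const, Finset.card_univ, Fintype.card_fin,
          nsmul_eq_mul]
        rw [hτ]
        have : (M : ℝ) * -(1 / 2) / K = -(M / K / 2) := by ring
        rw [this]
        nlinarith
      · simp only [Option.elim]
        rw [hτ, ← Finset.mul_sum, ← Finset.sum_div]
        have : 2 * ((∑ m, a i m) / B) / K ≤ 2 * ((κ / B) * (M / K)) := by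
          calc 2 * ((∑ m, a i m) / B) / K ≤ 2 * ((M * κ) / B) / K := by gcongr; exact hsum i
            _ = _ := by ring
        nlinarith [mul_pos hcB hL])
    (by simpa [Fintype.card_option] using hc)
  refine ⟨f, fun u => ?_⟩
  have hN : (M : ℝ) / K / 4 < (Finset.univ.filter fun m => f m = u).card := by
    have := hf u none
    simp only [Option.elim, Finset.sum_const, nsmul_eq_mul] at this
    linarith
  have hpos : (0 : ℝ) < (Finset.univ.filter fun m => f m = u).card := by linarith
  refine ⟨by exact_mod_cast hpos, fun i => ?_⟩
  have h := hf u (some i)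
  simp only [Option.elim] at h
  rw [← Finset.sum_div, div_lt_iff₀ hB] at h
  have h2 : 4 * (κ / B * (M / K)) * B = 16 * κ * (M / K / 4) := by field_simp; ring
  nlinarith

/-- The Kullback–Leibler divergence (natural logarithm) on a finite type. -/
def finiteKL {Z : Type} [Fintype Z] (q P : Z → ℝ) : ℝ := ∑ z, q z * Real.log (q z / P z)

theorem sub_le_mul_log_div {x y : ℝ} (hx : 0 ≤ x) (hy : 0 ≤ y) (h : y = 0 → x = 0) :
    x - y ≤ x * Real.log (x / y) := by
  rcases hx.eq_or_lt with rfl | hx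
  · simpa using hy
  have hy' : 0 < y := hy.lt_of_ne fun h0 => hx.ne' (h h0.symm)
  have := Real.one_sub_inv_le_log_of_pos (div_pos hx hy')
  rw [inv_div] at this
  calc x - y = x * (1 - y / x) := by field_simp
    _ ≤ _ := mul_le_mul_of_nonneg_left this hx.le

theorem finiteKL_nonneg {Z : Type} [Fintype Z] {q P : Z → ℝ} (hq : IsProbDist q)
    (hP : IsProbDist P) (hac : ∀ z, P z = 0 → q z = 0) : 0 ≤ finiteKL q P := by
  calc 0 = ∑ z, (q z - P z) := by rw [Finset.sum_sub_distrib, hq.2, hP.2, sub_self]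
    _ ≤ _ := Finset.sum_le_sum fun z _ => sub_le_mul_log_div (hq.1 z) (hP.1 z) (hac z)

theorem finiteKL_le_log {Z : Type} [Fintype Z] {q P : Z → ℝ} {c : ℝ} (hq : IsProbDist q)
    (hP : ∀ z, 0 ≤ P z) (hc : ∀ z, q z ≤ c * P z) : finiteKL q P ≤ Real.log c := by
  calc finiteKL q P ≤ ∑ z, q z * Real.log c := by
        refine Finset.sum_le_sum fun z _ => ?_
        rcases (hq.1 z).eq_or_lt with h | h
        · simp [← h]
        · have hPz : 0 < P z := (hP z).lt_of_ne fun h0 => by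
            have := hc z
            rw [← h0, mul_zero] at this
            linarith
          refine mul_le_mul_of_nonneg_left (Real.log_le_log (div_pos h hPz) ?_) h.le
          exact (div_le_iff₀ hPz).2 (hc z)
    _ = Real.log c := by rw [← Finset.sum_mul, hq.2, one_mul]

/-- Convexity of the divergence in its first argument, for a uniform mixture. -/
theorem finiteKL_average_le {Z U : Type} [Fintype Z] (s : Finset U) (hs : s.Nonempty)
    (q : U → Z → ℝ) {P : Z → ℝ} (hq : ∀ m z, 0 ≤ q m z) (hP : ∀ z, 0 ≤ P z) :
    finiteKL (fun z => (s.card : ℝ)⁻¹ * ∑ m ∈ s, q m z) P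
      ≤ (s.card : ℝ)⁻¹ * ∑ m ∈ s, finiteKL (q m) P := by
  have hcard : (0 : ℝ) < s.card := by exact_mod_cast hs.card_pos
  unfold finiteKL
  rw [Finset.sum_comm, Finset.mul_sum]
  refine Finset.sum_le_sum fun z _ => ?_
  rcases (hP z).eq_or_lt with h0 | hPz
  · simp [← h0]
  have hconv := Real.convexOn_mul_log.map_sum_le (t := s) (w := fun _ => (s.card : ℝ)⁻¹)
    (p := fun m => q m z / P z) (fun _ _ => by positivity)
    (by simp [hcard.ne']) (fun m _ => div_nonneg (hq m z) (hP z))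
  simp only [smul_eq_mul] at hconv
  have hx : ∑ m ∈ s, (s.card : ℝ)⁻¹ * (q m z / P z)
      = ((s.card : ℝ)⁻¹ * ∑ m ∈ s, q m z) / P z := by
    rw [← Finset.mul_sum, ← Finset.sum_div, mul_div_assoc]
  rw [hx] at hconv
  have := mul_le_mul_of_nonneg_left hconv hPz.le
  calc _ = P z * ((((s.card : ℝ)⁻¹ * ∑ m ∈ s, q m z) / P z) *
        Real.log (((s.card : ℝ)⁻¹ * ∑ m ∈ s, q m z) / P z)) := by field_simp
    _ ≤ _ := this
    _ = _ := by
      rw [Finset.mul_sum, Finset.mul_sum]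
      refine Finset.sum_congr rfl fun m _ => ?_
      field_simp

theorem mutualInfo_eq_sum_finiteKL {U Z : Type} [Fintype U] [Fintype Z] (p : U → ℝ)
    (q : U → Z → ℝ) :
    mutualInfo p q = ∑ u, p u * finiteKL (q u) (fun z => ∑ v, p v * q v z) := by
  unfold mutualInfo finiteKL
  refine Finset.sum_congr rfl fun u _ => ?_
  rw [Finset.mul_sum]
  exact Finset.sum_congr rfl fun z _ => by ring

theorem IsProbDist.mixture {U Z : Type} [Fintype U] [Fintype Z] {p : U → ℝ} {q : U → Z → ℝ}
    (hp : IsProbDist p) (hq : ∀ u, IsProbDist (q u)) :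
    IsProbDist fun z => ∑ u, p u * q u z := by
  refine ⟨fun z => Finset.sum_nonneg fun u _ => mul_nonneg (hp.1 u) ((hq u).1 z), ?_⟩
  rw [Finset.sum_comm]
  simp [← Finset.mul_sum, (hq _).2, hp.2]

/-- Mutual information is at most the mean divergence to any common reference distribution. -/
theorem mutualInfo_le_sum_finiteKL {U Z : Type} [Fintype U] [Fintype Z] {p : U → ℝ}
    {q : U → Z → ℝ} {P : Z → ℝ} (hp : IsProbDist p) (hq : ∀ u, IsProbDist (q u))
    (hP : IsProbDist P) (hac : ∀ u z, P z = 0 → q u z = 0) :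
    mutualInfo p q ≤ ∑ u, p u * finiteKL (q u) P := by
  have hQ := hp.mixture hq
  have hQP : 0 ≤ finiteKL (fun z => ∑ v, p v * q v z) P :=
    finiteKL_nonneg hQ hP fun z hz => by simp [hac _ z hz]
  have hsplit : finiteKL (fun z => ∑ v, p v * q v z) P
      = ∑ u, p u * ∑ z, q u z * Real.log ((∑ v, p v * q v z) / P z) := by
    unfold finiteKL
    simp only [Finset.mul_sum, Finset.sum_mul]
    rw [Finset.sum_comm]
    exact Finset.sum_congr rfl fun u _ => Finset.sum_congr rfl fun z _ => by ring
  have hdecomp : ∑ u, p u * finiteKL (q u) P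
      = mutualInfo p q + finiteKL (fun z => ∑ v, p v * q v z) P := by
    rw [hsplit, mutualInfo_eq_sum_finiteKL, ← Finset.sum_add_distrib]
    refine Finset.sum_congr rfl fun u _ => ?_
    rw [← mul_add]
    unfold finiteKL
    rw [← Finset.sum_add_distrib]
    rcases (hp.1 u).eq_or_lt with h | hpu
    · simp [← h]
    congr 1
    refine Finset.sum_congr rfl fun z _ => ?_
    rcases ((hq u).1 z).eq_or_lt with h | hquz
    · simp [← h]
    have hPz : P z ≠ 0 := fun h => hquz.ne' (hac u z h)
    have hQz : 0 < ∑ v, p v * q v z :=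
      (mul_pos hpu hquz).trans_le (Finset.single_le_sum (f := fun v => p v * q v z)
        (fun v _ => mul_nonneg (hp.1 v) ((hq v).1 z)) (Finset.mem_univ u))
    rw [Real.log_div hquz.ne' hPz, Real.log_div hquz.ne' hQz.ne', Real.log_div hQz.ne' hPz]
    ring
  linarith

theorem Zout_isProbDist {U X Z : Type} [Fintype X] [Fintype Z] {Φ : U → X → ℝ} {V : X → Z → ℝ}
    (hV : IsChannel V) (hΦ : ∀ u, IsProbDist (Φ u)) (u : U) : IsProbDist (Zout Φ V u) :=
  (hΦ u).mixture hV

theorem errProb_nonneg {U X Y : Type} [Fintype X] [Fintype Y] [DecidableEq U]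
    {W : X → Y → ℝ} {Φ : U → X → ℝ} (hW : IsChannel W) (hΦ : ∀ u, IsProbDist (Φ u))
    (ψ : Y → U) (u : U) : 0 ≤ errProb W Φ ψ u :=
  Finset.sum_nonneg fun y _ => by
    split_ifs
    exacts [(Zout_isProbDist hW hΦ u).1 y, le_rfl]

theorem errProb_le_one {U X Y : Type} [Fintype X] [Fintype Y] [DecidableEq U]
    {W : X → Y → ℝ} {Φ : U → X → ℝ} (hW : IsChannel W) (hΦ : ∀ u, IsProbDist (Φ u))
    (ψ : Y → U) (u : U) : errProb W Φ ψ u ≤ 1 := by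
  rw [← (Zout_isProbDist hW hΦ u).2]
  exact Finset.sum_le_sum fun y _ => by
    split_ifs
    exacts [le_rfl, (Zout_isProbDist hW hΦ u).1 y]

/-- The encoder that sends a uniformly chosen old message of color `u`. -/
def colorEncoder {M K : ℕ} {X : Type} (f : Fin M → Fin K) (Φ : Fin M → X → ℝ)
    (u : Fin K) (x : X) : ℝ :=
  ((Finset.univ.filter fun m => f m = u).card : ℝ)⁻¹ * ∑ m with f m = u, Φ m x

theorem colorEncoder_isProbDist {M K : ℕ} {X : Type} [Fintype X] {f : Fin M → Fin K}
    {Φ : Fin M → X → ℝ} (hΦ : ∀ m, IsProbDist (Φ m)) (u : Fin K)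
    (hu : 0 < (Finset.univ.filter fun m => f m = u).card) :
    IsProbDist (colorEncoder f Φ u) := by
  refine ⟨fun x => mul_nonneg (by positivity) (Finset.sum_nonneg fun m _ => (hΦ m).1 x), ?_⟩
  unfold colorEncoder
  rw [← Finset.mul_sum, Finset.sum_comm]
  have : ((Finset.univ.filter fun m => f m = u).card : ℝ) ≠ 0 := by exact_mod_cast hu.ne'
  simp [(hΦ _).2, this]

theorem Zout_colorEncoder {M K : ℕ} {X Z : Type} [Fintype X] (f : Fin M → Fin K)
    (Φ : Fin M → X → ℝ) (V : X → Z → ℝ) (u : Fin K) (z : Z) :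
    Zout (colorEncoder f Φ) V u z =
      ((Finset.univ.filter fun m => f m = u).card : ℝ)⁻¹ * ∑ m with f m = u, Zout Φ V m z := by
  unfold Zout colorEncoder
  simp only [Finset.mul_sum, Finset.sum_mul]
  rw [Finset.sum_comm]
  exact Finset.sum_congr rfl fun _ _ => Finset.sum_congr rfl fun _ _ => by ring

theorem errProb_colorEncoder_le {M K : ℕ} {X Y : Type} [Fintype X] [Fintype Y]
    {W : X → Y → ℝ} {Φ : Fin M → X → ℝ} (hW : IsChannel W) (hΦ : ∀ u, IsProbDist (Φ u))
    (ψ : Y → Fin M) (f : Fin M → Fin K) (u : Fin K) :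
    errProb W (colorEncoder f Φ) (f ∘ ψ) u ≤
      ((Finset.univ.filter fun m => f m = u).card : ℝ)⁻¹ *
        ∑ m with f m = u, errProb W Φ ψ m := by
  unfold errProb
  rw [Finset.sum_comm, Finset.mul_sum]
  refine Finset.sum_le_sum fun y _ => ?_
  have hnn : ∀ m, 0 ≤ Zout Φ W m y := fun m => (Zout_isProbDist hW hΦ m).1 y
  split_ifs with h
  · rw [Zout_colorEncoder]
    refine mul_le_mul_of_nonneg_left (Finset.sum_le_sum fun m hm => ?_) (by positivity)
    rw [if_pos]
    rintro rfl
    exact h (Finset.mem_filter.1 hm).2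
  · exact mul_nonneg (by positivity) (Finset.sum_nonneg fun m _ => by
      split_ifs
      exacts [hnn m, le_rfl])

/-- Regrouping messages turns an average-error, strongly secret code into a maximal-error,
semantically secure one with fewer messages. -/
theorem exists_semantic_code {X Y Z S T : Type} [Fintype X] [Fintype Y] [Fintype Z]
    [Fintype S] [Fintype T] {W : S → X → Y → ℝ} {V : T → X → Z → ℝ}
    (hW : ∀ s, IsChannel (W s)) (hV : ∀ t, IsChannel (V t)) {M K : ℕ} (hK : 0 < K)
    {Φ : Fin M → X → ℝ} (ψ : Y → Fin M) (hΦ : ∀ m, IsProbDist (Φ m)) {κ : ℝ}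
    (hκ : 0 < κ) (hκ1 : κ ≤ 1) (hM : 1 ≤ Real.log M)
    (herr : ∀ s, ∑ m, (M : ℝ)⁻¹ * errProb (W s) Φ ψ m ≤ κ)
    (hsec : ∀ t, mutualInfo (fun _ : Fin M => (M : ℝ)⁻¹) (fun m => Zout Φ (V t) m) ≤ κ)
    (hc : ((Fintype.card S : ℝ) + Fintype.card T + 1) * K
      < Real.exp (κ * M / (4 * Real.log M * K))) :
    ∃ (Φ' : Fin K → X → ℝ) (ψ' : Y → Fin K), (∀ u, IsProbDist (Φ' u)) ∧
      (∀ s u, errProb (W s) Φ' ψ' u ≤ 16 * κ) ∧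
      ∀ t (p : Fin K → ℝ), IsProbDist p → mutualInfo p (fun u => Zout Φ' (V t) u) ≤ 16 * κ := by
  have hM0 : (0 : ℝ) < M := by
    rcases Nat.eq_zero_or_pos M with rfl | h
    · norm_num at hM
    · exact_mod_cast h
  let P : T → Z → ℝ := fun t z => ∑ m, (M : ℝ)⁻¹ * Zout Φ (V t) m z
  have hunif : IsProbDist fun _ : Fin M => (M : ℝ)⁻¹ :=
    ⟨fun _ => by positivity, by simp [hM0.ne']⟩
  have hZ : ∀ t m, IsProbDist (Zout Φ (V t) m) := fun t => Zout_isProbDist (hV t) hΦ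
  have hP : ∀ t, IsProbDist (P t) := fun t => hunif.mixture (hZ t)
  have hdom : ∀ t m z, Zout Φ (V t) m z ≤ M * P t z := by
    intro t m z
    have h := Finset.single_le_sum (f := fun m => (M : ℝ)⁻¹ * Zout Φ (V t) m z)
      (fun m _ => mul_nonneg (by positivity) ((hZ t m).1 z)) (Finset.mem_univ m)
    calc Zout Φ (V t) m z = M * ((M : ℝ)⁻¹ * Zout Φ (V t) m z) := by field_simp
      _ ≤ _ := mul_le_mul_of_nonneg_left h hM0.le
  have hac : ∀ t m z, P t z = 0 → Zout Φ (V t) m z = 0 := fun t m z h =>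
    le_antisymm (by simpa [h] using hdom t m z) ((hZ t m).1 z)
  obtain ⟨f, hf⟩ := exists_coloring_average_le (ι := S ⊕ T) hK
    (Sum.elim (fun s m => errProb (W s) Φ ψ m) (fun t m => finiteKL (Zout Φ (V t) m) (P t)))
    hκ (hκ1.trans hM)
    (by
      rintro (s | t) m
      · exact errProb_nonneg (hW s) hΦ ψ m
      · exact finiteKL_nonneg (hZ t m) (hP t) (hac t m))
    (by
      rintro (s | t) m
      · exact (errProb_le_one (hW s) hΦ ψ m).trans hM
      · exact finiteKL_le_log (hZ t m) (hP t).1 (hdom t m))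
    (by
      rintro (s | t)
      · have h := herr s
        rw [← Finset.mul_sum, inv_mul_le_iff₀ hM0] at h
        exact h
      · have h := hsec t
        rw [mutualInfo_eq_sum_finiteKL, ← Finset.mul_sum, inv_mul_le_iff₀ hM0] at h
        exact h)
    (by simpa [Fintype.card_sum] using hc)
  have hΦ' : ∀ u, IsProbDist (colorEncoder f Φ u) := fun u =>
    colorEncoder_isProbDist hΦ u (hf u).1
  have havg : ∀ (u : Fin K) (x : ℝ), x ≤ 16 * κ * (Finset.univ.filter fun m => f m = u).card →
      ((Finset.univ.filter fun m => f m = u).card : ℝ)⁻¹ * x ≤ 16 * κ := by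
    intro u x hx
    rw [inv_mul_le_iff₀ (by exact_mod_cast (hf u).1)]
    linarith
  refine ⟨colorEncoder f Φ, f ∘ ψ, hΦ', fun s u => ?_, fun t p hp => ?_⟩
  · exact (errProb_colorEncoder_le (hW s) hΦ ψ f u).trans (havg u _ ((hf u).2 (Sum.inl s)))
  · have hout : ∀ u, Zout (colorEncoder f Φ) (V t) u = fun z =>
        ((Finset.univ.filter fun m => f m = u).card : ℝ)⁻¹ *
          ∑ m with f m = u, Zout Φ (V t) m z := fun u =>
      funext fun z => Zout_colorEncoder f Φ (V t) u z
    calc mutualInfo p (fun u => Zout (colorEncoder f Φ) (V t) u)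
        ≤ ∑ u, p u * finiteKL (Zout (colorEncoder f Φ) (V t) u) (P t) := by
          refine mutualInfo_le_sum_finiteKL hp (Zout_isProbDist (hV t) hΦ') (hP t)
            fun u z hz => ?_
          rw [Zout_colorEncoder]
          simp [hac t _ z hz]
      _ ≤ ∑ u, p u * (16 * κ) := by
          refine Finset.sum_le_sum fun u _ => mul_le_mul_of_nonneg_left ?_ (hp.1 u)
          rw [hout u]
          exact (finiteKL_average_le _ (Finset.card_pos.1 (hf u).1) _
            (fun m => (hZ t m).1) (hP t).1).trans (havg u _ ((hf u).2 (Sum.inr t)))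
      _ = 16 * κ := by rw [← Finset.sum_mul, hp.2, one_mul]

theorem natCast_le_exp_of_loglog_le {N : ℕ} {x : ℝ} (h : loglog N ≤ x) :
    (N : ℝ) ≤ Real.exp ((2 : ℝ) ^ x) := by
  rcases Nat.eq_zero_or_pos N with rfl | hN
  · simpa using (Real.exp_pos _).le
  have hN' : (0 : ℝ) < N := by exact_mod_cast hN
  rw [← Real.log_le_iff_le_exp hN']
  have hx : (0 : ℝ) < (2 : ℝ) ^ x := by positivity
  rcases le_or_gt (Real.logb 2 N) 0 with h0 | h0
  · have := (Real.logb_nonpos_iff (by norm_num) hN').1 h0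
    exact (Real.log_nonpos hN'.le this).trans hx.le
  · have hL : Real.logb 2 N ≤ (2 : ℝ) ^ x := (Real.logb_le_iff_le_rpow (by norm_num) h0).1 h
    have hlog : Real.log N = Real.logb 2 N * Real.log 2 := by
      rw [Real.logb, div_mul_cancel₀ _ (Real.log_pos (by norm_num)).ne']
    rw [hlog]
    nlinarith [Real.log_two_lt_d9]

/-- Exponential growth beats the quadratic-times-linear bound arising from the union bound. -/
theorem eventually_mul_lt_mul_sq {R δ κ : ℝ} (hR : 0 < R) (hδ : 0 < δ) (hκ : 0 < κ) :
    ∀ᶠ n : ℕ in Filter.atTop, 1 ≤ n ∧ 2 ≤ (2 : ℝ) ^ (n * δ) ∧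
      8 * (n * R) * ((2 : ℝ) ^ (n * δ) + 2 + n * R) < κ * ((2 : ℝ) ^ (n * δ)) ^ 2 := by
  have hb : 0 < Real.log 2 * δ := mul_pos (Real.log_pos (by norm_num)) hδ
  have hη : 0 < κ / (16 * (R * (3 + R))) := by positivity
  have ho := (isLittleO_pow_exp_pos_mul_atTop (k := 2) hb).comp_tendsto
    (tendsto_natCast_atTop_atTop (R := ℝ))
  have hlarge : Filter.Tendsto (fun n : ℕ => (n : ℝ) * δ) Filter.atTop Filter.atTop :=
    tendsto_natCast_atTop_atTop.atTop_mul_const hδ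
  filter_upwards [ho.bound hη, Filter.eventually_ge_atTop 1, hlarge.eventually_ge_atTop 1]
    with n hn hn1 hnδ
  have hE : (2 : ℝ) ^ (n * δ) = Real.exp (Real.log 2 * δ * n) := by
    rw [Real.rpow_def_of_pos (by norm_num)]
    ring_nf
  simp only [Function.comp_apply, Real.norm_eq_abs, ← hE, abs_pow, Nat.abs_cast,
    abs_of_pos (by positivity : (0 : ℝ) < (2 : ℝ) ^ (n * δ))] at hn
  have hE2 : 2 ≤ (2 : ℝ) ^ (n * δ) := by
    simpa using Real.rpow_le_rpow_of_exponent_le (by norm_num : (1 : ℝ) ≤ 2) hnδ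
  refine ⟨hn1, hE2, ?_⟩
  set E := (2 : ℝ) ^ (n * δ)
  have hn1' : (1 : ℝ) ≤ n := by exact_mod_cast hn1
  have h1 : E + 2 + n * R ≤ n * E * (3 + R) := by
    nlinarith [mul_nonneg (sub_nonneg.2 hn1') (by linarith : 0 ≤ E),
      mul_nonneg (mul_nonneg (by linarith : (0 : ℝ) ≤ n) hR.le) (by linarith : 0 ≤ E - 1)]
  calc 8 * (n * R) * (E + 2 + n * R) ≤ 8 * (n * R) * (n * E * (3 + R)) := by gcongr
    _ = 8 * (R * (3 + R)) * E * (n : ℝ) ^ 2 := by ring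
    _ ≤ 8 * (R * (3 + R)) * E * (κ / (16 * (R * (3 + R))) * E) := by gcongr
    _ = κ * E ^ 2 / 2 := by field_simp; ring
    _ < κ * E ^ 2 := half_lt_self (by positivity)

/-- The union bound needed to regroup at least `2 ^ (n (R - 2δ))` messages into at most
`2 · 2 ^ (n (R - 4δ))` classes. -/
theorem union_bound_lt {n : ℕ} {R δ κ S T M K : ℝ} (hδ : 0 < δ) (hR : 8 * δ ≤ R)
    (hκ : 0 < κ) (hn : 1 ≤ n) (hE2 : 2 ≤ (2 : ℝ) ^ (n * δ))
    (hE : 8 * (n * R) * ((2 : ℝ) ^ (n * δ) + 2 + n * R) < κ * ((2 : ℝ) ^ (n * δ)) ^ 2)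
    (hS : S ≤ Real.exp ((2 : ℝ) ^ (n * δ))) (hT : T ≤ Real.exp ((2 : ℝ) ^ (n * δ)))
    (hM : (2 : ℝ) ^ (n * (R - 2 * δ)) ≤ M) (hK0 : 0 < K)
    (hK : K ≤ 2 * (2 : ℝ) ^ (n * (R - 4 * δ))) :
    1 ≤ Real.log M ∧ (S + T + 1) * K < Real.exp (κ * M / (4 * Real.log M * K)) := by
  have hn' : (1 : ℝ) ≤ n := by exact_mod_cast hn
  have hRpos : 0 < R := by linarith
  set E := (2 : ℝ) ^ (n * δ) with hEdef
  set M₀ := (2 : ℝ) ^ (n * (R - 2 * δ)) with hM₀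
  set K₀ := (2 : ℝ) ^ (n * (R - 4 * δ)) with hK₀
  have hK₀pos : 0 < K₀ := by positivity
  have hsplit : M₀ = K₀ * E ^ 2 := by
    rw [hM₀, hK₀, hEdef, ← Real.rpow_natCast, ← Real.rpow_mul (by norm_num),
      ← Real.rpow_add (by norm_num)]
    congr 1
    push_cast
    ring
  have hK₀1 : 1 ≤ K₀ := Real.one_le_rpow (by norm_num) (mul_nonneg (by linarith) (by linarith))
  have hM₀4 : 4 ≤ M₀ := by rw [hsplit]; nlinarith
  have hexp1 : Real.exp 1 ≤ M₀ := by linarith [Real.exp_one_lt_d9]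
  have hM₀pos : 0 < M₀ := by linarith
  have hMpos : 0 < M := by linarith
  have hlogM₀1 : 1 ≤ Real.log M₀ := by
    rwa [Real.le_log_iff_exp_le hM₀pos]
  have hlogM1 : 1 ≤ Real.log M := hlogM₀1.trans (Real.log_le_log hM₀pos hM)
  refine ⟨hlogM1, ?_⟩
  have hlog2 : Real.log 2 ≤ 1 := by linarith [Real.log_two_lt_d9]
  have hlogM₀ : Real.log M₀ ≤ n * R := by
    rw [hM₀, Real.log_rpow (by norm_num)]
    have : (0 : ℝ) ≤ n * (R - 2 * δ) := mul_nonneg (by linarith) (by linarith)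
    nlinarith [mul_le_mul_of_nonneg_left hlog2 this]
  have hK₀exp : K₀ ≤ Real.exp (n * R) := by
    rw [hK₀, Real.rpow_def_of_pos (by norm_num)]
    apply Real.exp_le_exp.2
    have : (0 : ℝ) ≤ n * (R - 4 * δ) := mul_nonneg (by linarith) (by linarith)
    nlinarith [mul_le_mul_of_nonneg_right hlog2 this]
  have hanti : Real.log M / M ≤ Real.log M₀ / M₀ :=
    Real.log_div_self_antitoneOn hexp1 (hexp1.trans hM) hM
  have hratio : M₀ / Real.log M₀ ≤ M / Real.log M := by
    have := inv_anti₀ (div_pos (by linarith) hMpos) hanti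
    rwa [inv_div, inv_div] at this
  have hexponent : E + 2 + n * R < κ * M / (4 * Real.log M * K) := by
    calc E + 2 + n * R < κ * E ^ 2 / (8 * (n * R)) := by
          rw [lt_div_iff₀ (by positivity)]; linarith
      _ ≤ κ * E ^ 2 / (8 * Real.log M₀) := by gcongr
      _ = κ / (4 * (2 * K₀)) * (M₀ / Real.log M₀) := by
          rw [hsplit]; field_simp; ring
      _ ≤ κ / (4 * K) * (M / Real.log M) := by gcongr
      _ = _ := by field_simp
  refine lt_of_le_of_lt ?_ (Real.exp_lt_exp.2 hexponent)
  have hexp2 : 6 ≤ Real.exp 2 := by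
    have : Real.exp 2 = Real.exp 1 * Real.exp 1 := by rw [← Real.exp_add]; norm_num
    nlinarith [Real.exp_one_gt_d9]
  have hone : 1 ≤ Real.exp E := Real.one_le_exp (by linarith)
  calc (S + T + 1) * K ≤ (3 * Real.exp E) * (2 * Real.exp (n * R)) :=
        mul_le_mul (by linarith) (by linarith) hK0.le (by positivity)
    _ = Real.exp E * 6 * Real.exp (n * R) := by ring
    _ ≤ Real.exp E * Real.exp 2 * Real.exp (n * R) := by gcongr
    _ = _ := by rw [Real.exp_add, Real.exp_add]

theorem GAVWC.achAStr_of_achMMis {C : GAVWC} {R : ℝ} (h : C.achMMis R) : C.achAStr R := by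
  refine ⟨h.1, fun ε hε lam hlam mu hmu => ?_⟩
  obtain ⟨N, hN⟩ := h.2 ε hε lam hlam mu hmu
  refine ⟨N, fun n hn => ?_⟩
  let _ := C.fX n; let _ := C.fY n; let _ := C.fZ n
  obtain ⟨M, Φ, ψ, hM, hΦ, hrate, herr, hsec⟩ := hN n hn
  have hM' : (M : ℝ) ≠ 0 := by exact_mod_cast hM.ne'
  refine ⟨M, Φ, ψ, hM, hΦ, hrate, fun s => ?_, fun s => hsec s _ ⟨fun _ => by positivity, by
    simp [hM']⟩⟩
  calc ∑ u, (M : ℝ)⁻¹ * errProb (C.W n s) Φ ψ u ≤ ∑ _u : Fin M, (M : ℝ)⁻¹ * lam :=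
        Finset.sum_le_sum fun u _ => mul_le_mul_of_nonneg_left (herr s u) (by positivity)
    _ = lam := by simp [hM']

theorem eventually_natCast_le_exp {c : ℕ → ℕ} {δ : ℝ} (hδ : 0 < δ)
    (h : Filter.Tendsto (fun n : ℕ => (n : ℝ)⁻¹ * loglog (c n)) Filter.atTop (nhds 0)) :
    ∀ᶠ n : ℕ in Filter.atTop, (c n : ℝ) ≤ Real.exp ((2 : ℝ) ^ (n * δ)) := by
  filter_upwards [h.eventually_lt_const hδ, Filter.eventually_ge_atTop 1] with n hn hn1
  have hn0 : (0 : ℝ) < n := by exact_mod_cast hn1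
  exact natCast_le_exp_of_loglog_le ((inv_mul_le_iff₀ hn0).1 hn.le)

/-- A single-message code has no error and leaks nothing. -/
theorem exists_trivial_code {X Y Z S T : Type} [Fintype X] [Nonempty X] [Fintype Y] [Fintype Z]
    (W : S → X → Y → ℝ) (V : T → X → Z → ℝ) :
    ∃ (Φ : Fin 1 → X → ℝ) (ψ : Y → Fin 1), (∀ u, IsProbDist (Φ u)) ∧
      (∀ s u, errProb (W s) Φ ψ u = 0) ∧
      ∀ t (p : Fin 1 → ℝ), IsProbDist p → mutualInfo p (fun u => Zout Φ (V t) u) = 0 := by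
  classical
  obtain ⟨x₀⟩ := ‹Nonempty X›
  refine ⟨fun _ x => if x = x₀ then 1 else 0, fun _ => 0, fun u => ⟨fun x => ?_, by simp⟩,
    fun s u => ?_, fun t p hp => ?_⟩
  · dsimp only; split_ifs <;> norm_num
  · simp [errProb, Subsingleton.elim (0 : Fin 1) u]
  · have hp0 : p 0 = 1 := by simpa using hp.2
    unfold mutualInfo
    simp only [Fin.sum_univ_one, hp0, one_mul]
    refine Finset.sum_eq_zero fun z _ => ?_
    rcases eq_or_ne (Zout (fun _ : Fin 1 => fun x => if x = x₀ then (1 : ℝ) else 0) (V t) 0 z) 0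
      with h | h
    · simp [h]
    · simp [div_self h]

theorem GAVWC.achMMis_of_achAStr {C : GAVWC} {R : ℝ}
    (hW : Filter.Tendsto (fun n : ℕ => (n : ℝ)⁻¹ * loglog (C.cardW n))
      Filter.atTop (nhds 0))
    (hV : Filter.Tendsto (fun n : ℕ => (n : ℝ)⁻¹ * loglog (C.cardV n))
      Filter.atTop (nhds 0))
    (h : C.achAStr R) : C.achMMis R := by
  refine ⟨h.1, fun ε hε lam hlam mu hmu => ?_⟩
  rcases lt_or_ge R ε with hRε | hRε
  · refine ⟨0, fun n _ => ?_⟩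
    let _ := C.fX n; let _ := C.fY n; let _ := C.fZ n
    have := C.neX n
    obtain ⟨Φ, ψ, hΦ, herr, hsec⟩ := exists_trivial_code (C.W n) (C.V n)
    exact ⟨1, Φ, ψ, one_pos, hΦ, by simpa using hRε, fun s u => (herr s u).le.trans hlam.le,
      fun s p hp => (hsec s p hp).le.trans hmu.le⟩
  obtain ⟨δ, rfl⟩ : ∃ δ, ε = 8 * δ := ⟨ε / 8, by ring⟩
  have hδ : 0 < δ := by linarith
  have hR : 0 < R := by linarith
  obtain ⟨κ, hκ, hκ1, hκlam, hκmu⟩ :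
      ∃ κ > 0, κ ≤ 1 ∧ 16 * κ ≤ lam ∧ 16 * κ ≤ mu := by
    refine ⟨min 1 (min (lam / 16) (mu / 16)), by positivity, min_le_left _ _, ?_, ?_⟩
    · have : min 1 (min (lam / 16) (mu / 16)) ≤ lam / 16 :=
        (min_le_right _ _).trans (min_le_left _ _)
      linarith
    · have : min 1 (min (lam / 16) (mu / 16)) ≤ mu / 16 :=
        (min_le_right _ _).trans (min_le_right _ _)
      linarith
  obtain ⟨N, hN⟩ := h.2 (2 * δ) (by linarith) κ hκ κ hκ
  obtain ⟨N', hN'⟩ := Filter.eventually_atTop.1 ((Filter.eventually_ge_atTop N).and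
    ((eventually_mul_lt_mul_sq hR hδ hκ).and
      ((eventually_natCast_le_exp hδ hW).and (eventually_natCast_le_exp hδ hV))))
  refine ⟨N', fun n hn => ?_⟩
  obtain ⟨hnN, ⟨hn1, hE2, hE⟩, hcW, hcV⟩ := hN' n hn
  let _ := C.fX n; let _ := C.fY n; let _ := C.fZ n; let _ := C.fSW n; let _ := C.fSV n
  obtain ⟨M, Φ, ψ, hM, hΦ, hrate, herr, hsec⟩ := hN n hnN
  have hn0 : (0 : ℝ) < n := by exact_mod_cast hn1
  have hM0 : (0 : ℝ) < M := by exact_mod_cast hM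
  have hMlow : (2 : ℝ) ^ (n * (R - 2 * δ)) ≤ M :=
    (Real.le_logb_iff_rpow_le (by norm_num) hM0).1 ((lt_inv_mul_iff₀ hn0).1 hrate).le
  have hK1 : 1 ≤ (2 : ℝ) ^ (n * (R - 4 * δ)) :=
    Real.one_le_rpow (by norm_num) (mul_nonneg hn0.le (by linarith))
  have hKlow := Nat.le_ceil ((2 : ℝ) ^ (n * (R - 4 * δ)))
  have hKup := (Nat.ceil_lt_add_one (by positivity : 0 ≤ (2 : ℝ) ^ (n * (R - 4 * δ)))).le
  set K := ⌈(2 : ℝ) ^ (n * (R - 4 * δ))⌉₊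
  have hK0 : (0 : ℝ) < K := by linarith
  obtain ⟨hlogM, hunion⟩ := union_bound_lt hδ hRε hκ hn1 hE2 hE hcW hcV hMlow hK0
    (by linarith)
  obtain ⟨Φ', ψ', hΦ', herr', hsec'⟩ := exists_semantic_code (C.chanW n) (C.chanV n)
    (by exact_mod_cast hK0) ψ hΦ hκ hκ1 hlogM herr hsec hunion
  refine ⟨K, Φ', ψ', by exact_mod_cast hK0, hΦ', ?_, fun s u => (herr' s u).trans hκlam,
    fun s p hp => (hsec' s p hp).trans hκmu⟩
  have hlogK : n * (R - 4 * δ) ≤ Real.logb 2 K :=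
    (Real.le_logb_iff_rpow_le (by norm_num) hK0).2 hKlow
  have := (le_inv_mul_iff₀ hn0).2 hlogK
  linarith

/-- If `(1/n)·log₂ log₂ |𝒲ⁿ| → 0`, `(1/n)·log₂ log₂ |𝒱ⁿ| → 0` and
`(1/n)·log₂ log₂ (1/vₙ) → 0` (with `log₂ log₂` of a quantity equal to `1` read as `0`),
then the capacity with average error and strong secrecy equals the capacity with maximal
error and mutual-information (semantic) security. -/
theorem gavwc_CaStr_eq_CmMis_of_subdoubleexp (C : GAVWC)
    (hW : Filter.Tendsto (fun n : ℕ => (n : ℝ)⁻¹ * loglog (C.cardW n))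
      Filter.atTop (nhds 0))
    (hV : Filter.Tendsto (fun n : ℕ => (n : ℝ)⁻¹ * loglog (C.cardV n))
      Filter.atTop (nhds 0))
    (hv : Filter.Tendsto (fun n : ℕ => (n : ℝ)⁻¹ * loglog (C.vmin n)⁻¹)
      Filter.atTop (nhds 0)) :
    C.CaStr = C.CmMis := by
  unfold GAVWC.CaStr GAVWC.CmMis
  congr 1
  ext R
  exact ⟨GAVWC.achMMis_of_achAStr hW hV, GAVWC.achAStr_of_achMMis⟩

end
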